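/- arXiv:1506.04324 — 2 statements merged into one kernel-verified Lean document; each statement's English description precedes it below -/
import Mathlib

section
/- For every real x and every real p, the sequence of complex numbers n·exp(−i·x·p/√n)·[1 + p·(exp(ix/√n) − 1)] − n converges, as n → ∞, to −(1/2)·p·(1 − p)·x². -/
open Filter Topology

/-- The second-order expansion of the exponential along the sequence `c / √n`. -/
theorem tendsto_natCast_mul_exp_div_sqrt_sub (c : ℂ) :
    Tendsto (fun n : ℕ => (n : ℂ) * (Complex.exp (c / Real.sqrt n) - 1 - c / Real.sqrt n))
      atTop (𝓝 (c ^ 2 / 2)) := by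
  have hsqrt : Tendsto (fun n : ℕ => c / (Real.sqrt n : ℂ)) atTop (𝓝 0) := by
    have h : Tendsto (fun n : ℕ => ((Real.sqrt n)⁻¹ : ℝ)) atTop (𝓝 0) :=
      (Real.tendsto_sqrt_atTop.comp tendsto_natCast_atTop_atTop).inv_tendsto_atTop
    simpa [div_eq_mul_inv] using
      ((Complex.continuous_ofReal.tendsto 0).comp h).const_mul c
  have hsq : ∀ᶠ n : ℕ in atTop, (n : ℂ) * (c / (Real.sqrt n : ℂ)) ^ 2 = c ^ 2 := by
    filter_upwards [eventually_ne_atTop 0] with n hn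
    have hn' : (n : ℂ) ≠ 0 := Nat.cast_ne_zero.mpr hn
    have h : ((Real.sqrt n : ℝ) : ℂ) ^ 2 = n := by
      rw [← Complex.ofReal_pow, Real.sq_sqrt n.cast_nonneg, Complex.ofReal_natCast]
    rw [div_pow, h]
    field_simp
  have hrem := (Asymptotics.isBigO_refl (fun n : ℕ => (n : ℂ)) atTop).mul_isLittleO
    ((Complex.exp_sub_sum_range_succ_isLittleO_pow 2).comp_tendsto hsqrt)
  have hzero := (hrem.congr' .rfl hsq).trans_isBigO
    (Asymptotics.isBigO_const_const (c ^ 2) (one_ne_zero (α := ℂ)) atTop)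
  have hlim := ((Asymptotics.isLittleO_one_iff ℂ).mp hzero).add_const (c ^ 2 / 2)
  rw [zero_add] at hlim
  refine hlim.congr' ?_
  filter_upwards [hsq] with n hn
  simp only [Function.comp_apply, Finset.sum_range_succ, Finset.sum_range_zero]
  norm_num
  linear_combination (-1 / 2 : ℂ) * hn

theorem tendsto_gaussian_part (x p : ℝ) :
    Tendsto (fun n : ℕ =>
        (n : ℂ) * Complex.exp (-(Complex.I * x * p / Real.sqrt n)) *
          (1 + (p : ℂ) * (Complex.exp (Complex.I * x / Real.sqrt n) - 1)) - (n : ℂ))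
      atTop (𝓝 (-(1/2 : ℂ) * p * (1 - (p : ℂ)) * x ^ 2)) := by
  have h := ((tendsto_natCast_mul_exp_div_sqrt_sub (-(Complex.I * x * p))).const_mul
    (1 - (p : ℂ))).add ((tendsto_natCast_mul_exp_div_sqrt_sub
      (Complex.I * x * (1 - p))).const_mul (p : ℂ))
  convert h using 1
  · funext n
    have hexp : Complex.exp (Complex.I * x * (1 - p) / Real.sqrt n) =
        Complex.exp (-(Complex.I * x * p / Real.sqrt n)) *
          Complex.exp (Complex.I * x / Real.sqrt n) := by
      rw [← Complex.exp_add]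
      congr 1
      ring
    rw [hexp, neg_div]
    ring
  · congr 1
    linear_combination (-(1 / 2 : ℂ) * p * (1 - p) * x ^ 2) * Complex.I_sq
end

section
/- Let F : ℝ → ℝ be nondecreasing and τ ∈ ℝ. Suppose that for every t > 0 the limit L(t) = lim_{n→∞} n·(F(τ + t/n) − F(τ)) exists in ℝ. Then F has a right-hand derivative at τ, i.e. ρ₂ = lim_{h↓0}(F(τ+h) − F(τ))/h exists, and L(t) = ρ₂·t for every t > 0. -/
open Filter Topology

/-- For a monotone function, convergence of the difference quotients along the steps `1 / n`
already gives the right derivative. -/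
theorem Monotone.tendsto_slope_right_of_tendsto_nat {F : ℝ → ℝ} (hF : Monotone F) {τ ρ : ℝ}
    (h : Tendsto (fun n : ℕ => (n : ℝ) * (F (τ + 1 / n) - F τ)) atTop (𝓝 ρ)) :
    Tendsto (fun h => (F (τ + h) - F τ) / h) (𝓝[>] (0 : ℝ)) (𝓝 ρ) := by
  have hinc : Tendsto (fun n : ℕ => F (τ + 1 / n) - F τ) atTop (𝓝 0) := by
    have h₁ := h.mul (tendsto_inv_atTop_nhds_zero_nat (𝕜 := ℝ))
    rw [mul_zero] at h₁
    refine h₁.congr' ?_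
    filter_upwards [eventually_gt_atTop 0] with n hn
    have : (n : ℝ) ≠ 0 := by positivity
    field_simp
  have hupper := h.add hinc
  have hlower := (h.sub hinc).comp (tendsto_add_atTop_nat 1)
  rw [add_zero] at hupper
  rw [sub_zero] at hlower
  have hfloor : Tendsto (fun x : ℝ => ⌊x⁻¹⌋₊) (𝓝[>] (0 : ℝ)) atTop :=
    tendsto_nat_floor_atTop.comp tendsto_inv_nhdsGT_zero
  refine tendsto_of_tendsto_of_tendsto_of_le_of_le' (hlower.comp hfloor) (hupper.comp hfloor) ?_ ?_
  · filter_upwards [self_mem_nhdsWithin] with x (hx : 0 < x)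
    have hle : (⌊x⁻¹⌋₊ : ℝ) ≤ x⁻¹ := Nat.floor_le (by positivity)
    have hlt : x⁻¹ < (⌊x⁻¹⌋₊ : ℝ) + 1 := Nat.lt_floor_add_one _
    simp only [Function.comp_apply, Nat.cast_add, Nat.cast_one]
    generalize (⌊x⁻¹⌋₊ : ℝ) = m at *
    have hm : 0 < m + 1 := (inv_pos.2 hx).trans hlt
    have hstep : 1 / (m + 1) ≤ x := by
      rw [one_div]
      exact inv_le_of_inv_le₀ hx hlt.le
    have h₀ : F τ ≤ F (τ + 1 / (m + 1)) := hF (by linarith [one_div_pos.2 hm])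
    have h₁ : F (τ + 1 / (m + 1)) ≤ F (τ + x) := hF (by linarith)
    calc (m + 1) * (F (τ + 1 / (m + 1)) - F τ) - (F (τ + 1 / (m + 1)) - F τ)
        = (F (τ + 1 / (m + 1)) - F τ) * m := by ring
      _ ≤ (F (τ + 1 / (m + 1)) - F τ) * x⁻¹ := mul_le_mul_of_nonneg_left hle (by linarith)
      _ ≤ (F (τ + x) - F τ) * x⁻¹ :=
        mul_le_mul_of_nonneg_right (by linarith) (inv_pos.2 hx).le
      _ = (F (τ + x) - F τ) / x := (div_eq_mul_inv _ _).symm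
  · filter_upwards [self_mem_nhdsWithin, hfloor.eventually_gt_atTop 0] with x (hx : 0 < x) hpos
    have hm : (0 : ℝ) < ⌊x⁻¹⌋₊ := Nat.cast_pos.2 hpos
    have hle : (⌊x⁻¹⌋₊ : ℝ) ≤ x⁻¹ := Nat.floor_le (by positivity)
    have hlt : x⁻¹ < (⌊x⁻¹⌋₊ : ℝ) + 1 := Nat.lt_floor_add_one _
    simp only [Function.comp_apply]
    generalize (⌊x⁻¹⌋₊ : ℝ) = m at *
    have hstep : x ≤ 1 / m := by
      rw [one_div]
      exact le_inv_of_le_inv₀ hm hle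
    have h₀ : F τ ≤ F (τ + x) := hF (by linarith)
    have h₁ : F (τ + x) ≤ F (τ + 1 / m) := hF (by linarith)
    calc (F (τ + x) - F τ) / x
        = (F (τ + x) - F τ) * x⁻¹ := div_eq_mul_inv _ _
      _ ≤ (F (τ + 1 / m) - F τ) * x⁻¹ :=
        mul_le_mul_of_nonneg_right (by linarith) (inv_pos.2 hx).le
      _ ≤ (F (τ + 1 / m) - F τ) * (m + 1) := mul_le_mul_of_nonneg_left hlt.le (by linarith)
      _ = m * (F (τ + 1 / m) - F τ) + (F (τ + 1 / m) - F τ) := by ring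

theorem rightDeriv_of_rescaled_limits (F : ℝ → ℝ) (hF : Monotone F) (τ : ℝ) (L : ℝ → ℝ)
    (hL : ∀ t : ℝ, 0 < t →
      Tendsto (fun n : ℕ => (n : ℝ) * (F (τ + t / n) - F τ)) atTop (𝓝 (L t))) :
    ∃ ρ₂ : ℝ, Tendsto (fun h => (F (τ + h) - F τ) / h) (𝓝[>] (0 : ℝ)) (𝓝 ρ₂) ∧
      ∀ t : ℝ, 0 < t → L t = ρ₂ * t := by
  have hderiv := hF.tendsto_slope_right_of_tendsto_nat (hL 1 one_pos)
  refine ⟨L 1, hderiv, fun t ht => ?_⟩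
  have hstep : Tendsto (fun n : ℕ => t / (n : ℝ)) atTop (𝓝[>] (0 : ℝ)) := by
    refine tendsto_nhdsWithin_iff.2 ⟨tendsto_const_div_atTop_nhds_zero_nat t, ?_⟩
    filter_upwards [eventually_gt_atTop 0] with n hn
    exact div_pos ht (Nat.cast_pos.2 hn)
  refine tendsto_nhds_unique (hL t ht) (((hderiv.comp hstep).mul_const t).congr' ?_)
  filter_upwards [eventually_gt_atTop 0] with n hn
  have : (n : ℝ) ≠ 0 := by positivity
  simp only [Function.comp_apply]
  field_simp
end
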